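/- Let 0<r<1 and let T be a bounded linear operator on a complex Hilbert space H belonging to the class C_α, with defect operator D. Then for every x ∈ H, ‖x‖² = (1−r²)^{−1} ∑_{n=0}^{∞} ‖DTⁿx‖² + (1−r²)^{−1} ∑_{n=1}^{∞} r^{2n−2}‖DT^{−n}x‖² + L⁺(T,x) + L⁻(T,x), with both series convergent. -/

import Mathlib

open ContinuousLinearMap Filter

/-- The operator `α(T*,T) = -T*²T² + (1+r²)T*T - r²I`. -/
noncomputable def alphaOp {H : Type*} [NormedAddCommGroup H] [InnerProductSpace ℂ H]
    [CompleteSpace H] (r : ℝ) (T : H →L[ℂ] H) : H →L[ℂ] H :=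
  -((adjoint T) ^ 2 * T ^ 2) + ((1 + r ^ 2 : ℝ) : ℂ) • (adjoint T * T)
    - ((r ^ 2 : ℝ) : ℂ) • (1 : H →L[ℂ] H)

theorem key_id {H : Type*} [NormedAddCommGroup H] [InnerProductSpace ℂ H] [CompleteSpace H]
    (r : ℝ) (T D : H →L[ℂ] H)
    (hDpos : D.IsPositive) (hDsq : D * D = alphaOp r T) (y : H) :
    ‖D y‖ ^ 2 = (1 + r ^ 2) * ‖T y‖ ^ 2 - ‖T (T y)‖ ^ 2 - r ^ 2 * ‖y‖ ^ 2 := by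
  have h1 : inner ℂ (D (D y)) y = inner ℂ (D y) (D y) := by
    have := hDpos.isSelfAdjoint.adjoint_eq
    conv_lhs => rw [← this]
    rw [adjoint_inner_left, this]
  have h2 : D (D y) = alphaOp r T y := by rw [← hDsq]; rfl
  rw [h2] at h1
  have h3 : alphaOp r T y = -(adjoint T (adjoint T (T (T y)))) +
      ((1 + r ^ 2 : ℝ) : ℂ) • (adjoint T (T y)) - ((r ^ 2 : ℝ) : ℂ) • y := by
    simp only [alphaOp, pow_two T, pow_two (adjoint T)]
    rfl
  rw [h3, inner_sub_left, inner_add_left, inner_neg_left, inner_smul_left, inner_smul_left,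
    adjoint_inner_left, adjoint_inner_left, adjoint_inner_left,
    inner_self_eq_norm_sq_to_K, inner_self_eq_norm_sq_to_K, inner_self_eq_norm_sq_to_K,
    inner_self_eq_norm_sq_to_K, Complex.conj_ofReal, Complex.conj_ofReal] at h1
  have h4 : -‖T (T y)‖ ^ 2 + (1 + r ^ 2) * ‖T y‖ ^ 2 - r ^ 2 * ‖y‖ ^ 2 = ‖D y‖ ^ 2 := by
    have h5 := h1
    simp only [Complex.coe_algebraMap] at h5
    exact_mod_cast h5
  linarith

/-- if `T ∈ C_α` (invertible with inverse `S`) with defect operator `D`, then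
`‖x‖² = (1-r²)⁻¹ ∑_{n≥0} ‖DTⁿx‖² + (1-r²)⁻¹ ∑_{n≥1} r^{2n-2}‖DT^{-n}x‖² + L⁺(T,x) + L⁻(T,x)`
for every `x`, with both series convergent (the second series is indexed by `n : ℕ`, the
term of index `n` being `r^{2n}‖DT^{-(n+1)}x‖²`). -/
theorem stmt7 {H : Type*} [NormedAddCommGroup H] [InnerProductSpace ℂ H] [CompleteSpace H]
    (r : ℝ) (hr0 : 0 < r) (hr1 : r < 1)
    (T S D : H →L[ℂ] H) (hTS : T * S = 1) (hST : S * T = 1)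
    (hDpos : D.IsPositive) (hDsq : D * D = alphaOp r T) :
    ∀ x : H, ∃ Lp Lm Sp Sm : ℝ,
      Tendsto (fun n : ℕ => ‖(T ^ n) x‖ ^ 2) atTop (nhds Lp) ∧
      Tendsto (fun n : ℕ => ‖(r ^ n : ℝ) • ((S ^ n) x)‖ ^ 2) atTop (nhds Lm) ∧
      HasSum (fun n : ℕ => ‖D ((T ^ n) x)‖ ^ 2) Sp ∧
      HasSum (fun n : ℕ => r ^ (2 * n) * ‖D ((S ^ (n + 1)) x)‖ ^ 2) Sm ∧
      ‖x‖ ^ 2 = (1 - r ^ 2)⁻¹ * Sp + (1 - r ^ 2)⁻¹ * Sm + Lp + Lm := by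
  
  have key := key_id r T D hDpos hDsq
  have hTSa : ∀ y, T (S y) = y := fun y => by
    have := congrArg (fun A : H →L[ℂ] H => A y) hTS
    simpa using this
  have hTn : ∀ n y, (T ^ (n + 1)) y = T ((T ^ n) y) := fun n y => by rw [pow_succ']; rfl
  have hSn : ∀ n y, (S ^ (n + 1)) y = S ((S ^ n) y) := fun n y => by rw [pow_succ']; rfl
  have hr2 : 0 < r ^ 2 := by positivity
  have hr2' : r ^ 2 < 1 := by nlinarith
  have hne : (1 - r ^ 2) ≠ 0 := by linarith
  have hcontr : ∀ y, ‖T y‖ ^ 2 ≤ ‖y‖ ^ 2 := by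
    intro y
    by_contra! hlt
    set δ := ‖T y‖ ^ 2 - ‖y‖ ^ 2 with hδ
    have hδ0 : 0 < δ := by linarith
    have h1 : ∀ n : ℕ, δ ≤ ‖T ((S ^ n) y)‖ ^ 2 - ‖(S ^ n) y‖ ^ 2 := by
      intro n
      induction n with
      | zero => simp [hδ]
      | succ n ih =>
        have hk := key ((S ^ (n + 1)) y)
        rw [hSn, hTSa] at *
        have := sq_nonneg ‖D (S ((S ^ n) y))‖
        nlinarith
    have h2 : ∀ n : ℕ, ‖(S ^ n) y‖ ^ 2 ≤ ‖y‖ ^ 2 - n * δ := by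
      intro n
      induction n with
      | zero => simp
      | succ n ih =>
        have := h1 (n + 1)
        rw [hSn, hTSa] at *
        rw [Nat.cast_succ]
        linarith
    obtain ⟨n, hn⟩ := exists_nat_gt (‖y‖ ^ 2 / δ)
    rw [div_lt_iff₀ hδ0] at hn
    have := h2 n
    have := sq_nonneg ‖(S ^ n) y‖
    linarith
  have hlim : ∀ y, ∃ L : ℝ, 0 ≤ L ∧ Tendsto (fun n : ℕ => ‖(T ^ n) y‖ ^ 2) atTop (nhds L) := by
    intro y
    have ha : Antitone (fun n : ℕ => ‖(T ^ n) y‖ ^ 2) :=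
      antitone_nat_of_succ_le fun n => by rw [hTn]; exact hcontr _
    have hb : BddBelow (Set.range (fun n : ℕ => ‖(T ^ n) y‖ ^ 2)) :=
      ⟨0, by rintro _ ⟨n, rfl⟩; positivity⟩
    have ht := tendsto_atTop_ciInf ha hb
    exact ⟨_, ge_of_tendsto' ht fun n => by positivity, ht⟩
  have hclim : ∀ y (L : ℝ), Tendsto (fun n : ℕ => ‖(T ^ n) y‖ ^ 2) atTop (nhds L) →
      Tendsto (fun n : ℕ => ‖(T ^ (n + 1)) y‖ ^ 2 - r ^ 2 * ‖(T ^ n) y‖ ^ 2) atTop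
        (nhds (L - r ^ 2 * L)) := by
    intro y L hL
    exact ((tendsto_add_atTop_iff_nat 1).2 hL).sub (hL.const_mul _)
  have hexp : ∀ y, r ^ 2 * ‖y‖ ^ 2 ≤ ‖T y‖ ^ 2 := by
    intro y
    obtain ⟨L, hL0, hL⟩ := hlim y
    have hc := hclim y L hL
    have ha : Antitone (fun n : ℕ => ‖(T ^ (n + 1)) y‖ ^ 2 - r ^ 2 * ‖(T ^ n) y‖ ^ 2) :=
      antitone_nat_of_succ_le fun n => by
        have hk := key ((T ^ n) y)
        have := sq_nonneg ‖D ((T ^ n) y)‖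
        simp only [hTn]
        linarith
    have h0 := ha.le_of_tendsto hc 0
    simp at h0
    nlinarith
  intro x
  obtain ⟨Lp, -, hLp⟩ := hlim x
  have hrS : ∀ n : ℕ, ‖(r ^ n : ℝ) • ((S ^ n) x)‖ ^ 2 = r ^ (2 * n) * ‖(S ^ n) x‖ ^ 2 := by
    intro n
    rw [norm_smul, mul_pow, Real.norm_eq_abs, sq_abs, ← pow_mul, mul_comm n 2]
  have hLm : ∃ Lm : ℝ, Tendsto (fun n : ℕ => r ^ (2 * n) * ‖(S ^ n) x‖ ^ 2) atTop (nhds Lm) := by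
    have ha : Antitone (fun n : ℕ => r ^ (2 * n) * ‖(S ^ n) x‖ ^ 2) :=
      antitone_nat_of_succ_le fun n => by
        have h := hexp ((S ^ (n + 1)) x)
        rw [hSn, hTSa] at *
        have hp : 0 < r ^ (2 * n) := by positivity
        calc r ^ (2 * (n + 1)) * ‖S ((S ^ n) x)‖ ^ 2
            = r ^ (2 * n) * (r ^ 2 * ‖S ((S ^ n) x)‖ ^ 2) := by ring
          _ ≤ _ := mul_le_mul_of_nonneg_left h hp.le
    have hb : BddBelow (Set.range (fun n : ℕ => r ^ (2 * n) * ‖(S ^ n) x‖ ^ 2)) :=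
      ⟨0, by rintro _ ⟨n, rfl⟩; positivity⟩
    exact ⟨_, tendsto_atTop_ciInf ha hb⟩
  obtain ⟨Lm, hLm⟩ := hLm
  refine ⟨Lp, Lm, (‖T x‖ ^ 2 - r ^ 2 * ‖x‖ ^ 2) - (Lp - r ^ 2 * Lp),
    (‖x‖ ^ 2 - ‖T x‖ ^ 2) - (Lm - r ^ 2 * Lm), hLp, ?_, ?_, ?_, ?_⟩
  · simpa only [hrS] using hLm
  · rw [hasSum_iff_tendsto_nat_of_nonneg (fun n => by positivity)]
    have hs : ∀ N : ℕ, ∑ n ∈ Finset.range N, ‖D ((T ^ n) x)‖ ^ 2 =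
        (‖T x‖ ^ 2 - r ^ 2 * ‖x‖ ^ 2) -
          (‖(T ^ (N + 1)) x‖ ^ 2 - r ^ 2 * ‖(T ^ N) x‖ ^ 2) := by
      intro N
      induction N with
      | zero => simp
      | succ N ih =>
        rw [Finset.sum_range_succ, ih, key]
        simp only [hTn]
        ring
    simp only [hs]
    exact (hclim x Lp hLp).const_sub _
  · rw [hasSum_iff_tendsto_nat_of_nonneg (fun n => by positivity)]
    rw [← tendsto_add_atTop_iff_nat 1]
    have hs : ∀ N : ℕ, ∑ n ∈ Finset.range (N + 1), r ^ (2 * n) * ‖D ((S ^ (n + 1)) x)‖ ^ 2 =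
        (‖x‖ ^ 2 - ‖T x‖ ^ 2) -
          (r ^ (2 * (N + 1)) * ‖(S ^ (N + 1)) x‖ ^ 2
            - r ^ 2 * (r ^ (2 * N) * ‖(S ^ N) x‖ ^ 2)) := by
      intro N
      induction N with
      | zero =>
        simp [key, hTSa]
        ring
      | succ N ih =>
        rw [Finset.sum_range_succ, ih, key]
        simp only [hSn, hTSa]
        ring
    simp only [hs]
    exact (((tendsto_add_atTop_iff_nat 1).2 hLm).sub (hLm.const_mul _)).const_sub _
  · field_simp
    ring
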